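/- Let f₁(s) = GB(s; a₁, c₁, d₁, u₁, v₁) and f₂(b) = GB(b; a₂, c₂, d₂, u₂, v₂) be generalized beta densities with all exponents nonnegative integers where needed for binomial expansion, and P = S + B with S, B independent with these densities. Then the marginal density of P admits the series representation f_P(p) = K₁ p^{a₁u₁ + a₂u₂ − 1} · Σ_{l,m,n,r ≥ 0} [(−1)^{l+m+n+r} (1−c₁)^l (1−c₂)^m c₁^n c₂^r / (d₁^{a₁(l+n)} d₂^{a₂(m+r)}) · C(v₁−1, l) C(v₂−1, m) C(u₁+v₁+n−1, n) C(u₂+v₂+r−1, r) · p^{a₁(l+n)+a₂(m+r)} · B(a₁(u₁+l+n) − 1 + 1, a₂(u₂+m+r) − 1 + 1)], with K₁ = |a₁||a₂|/(d₁^{a₁u₁} d₂^{a₂u₂} B(u₁,v₁) B(u₂,v₂)), whenever the series converges absolutely and the requisite integrals exist. -/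

import Mathlib

open MeasureTheory

/-- The Euler beta function. -/
noncomputable def rBeta (x y : ℝ) : ℝ := Real.Gamma x * Real.Gamma y / Real.Gamma (x + y)

/-- Generalized binomial coefficient `C(x, k)` for real `x`. -/
noncomputable def gbinom (x : ℝ) (k : ℕ) : ℝ :=
  (∏ i ∈ Finset.range k, (x - i)) / (Nat.factorial k)

/-- The generalized beta density `GB(x; a, c, d, u, v)` (on its support). -/
noncomputable def GBpdf (a c d u v x : ℝ) : ℝ :=
  |a| * x ^ (a * u - 1) * (1 - (1 - c) * (x / d) ^ a) ^ (v - 1)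
    / (d ^ (a * u) * rBeta u v * (1 + c * (x / d) ^ a) ^ (u + v))

/-- The general term of the quadruple series for the marginal density of `P = S + B`
under the generalized beta convolution. -/
noncomputable def gbTerm (a₁ c₁ d₁ u₁ v₁ a₂ c₂ d₂ u₂ v₂ p : ℝ) : ℕ × ℕ × ℕ × ℕ → ℝ :=
  fun (l, m, n, r) =>
    (-1 : ℝ) ^ (l + m + n + r) * (1 - c₁) ^ l * (1 - c₂) ^ m * c₁ ^ n * c₂ ^ r
        / (d₁ ^ (a₁ * ((l : ℝ) + n)) * d₂ ^ (a₂ * ((m : ℝ) + r)))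
      * gbinom (v₁ - 1) l * gbinom (v₂ - 1) m
      * gbinom (u₁ + v₁ + n - 1) n * gbinom (u₂ + v₂ + r - 1) r
      * p ^ (a₁ * ((l : ℝ) + n) + a₂ * ((m : ℝ) + r))
      * rBeta (a₁ * (u₁ + l + n)) (a₂ * (u₂ + m + r))

theorem gbinom_eq_choose (x : ℝ) (k : ℕ) : gbinom x k = Ring.choose x k := by
  have h : ∀ k : ℕ, (descPochhammer ℤ k).smeval x = ∏ i ∈ Finset.range k, (x - i) := by
    intro k
    induction k with
    | zero => simp
    | succ k ih =>
      rw [Finset.prod_range_succ, ← ih, descPochhammer_succ_right, Polynomial.smeval_mul]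
      simp [Polynomial.smeval_natCast]
  rw [Ring.choose_eq_smul, h, gbinom, smul_eq_mul, div_eq_inv_mul]

theorem rBeta_pos {x y : ℝ} (hx : 0 < x) (hy : 0 < y) : 0 < rBeta x y :=
  ProbabilityTheory.beta_pos hx hy

theorem integral_rpow_mul_sub_rpow {p α β : ℝ} (hp : 0 < p) (hα : 0 < α) (hβ : 0 < β) :
    ∫ s in Set.Ioo 0 p, s ^ (α - 1) * (p - s) ^ (β - 1) = p ^ (α + β - 1) * rBeta α β := by
  have h := Complex.betaIntegral_scaled (α : ℂ) (β : ℂ) hp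
  rw [intervalIntegral.integral_of_le hp.le, integral_Ioc_eq_integral_Ioo,
    Complex.betaIntegral_eq_Gamma_mul_div _ _ (by simpa) (by simpa)] at h
  apply Complex.ofReal_injective
  rw [rBeta, ← integral_complex_ofReal]
  push_cast [Complex.ofReal_cpow hp.le, ← Complex.Gamma_ofReal]
  rw [← h]
  refine setIntegral_congr_fun measurableSet_Ioo fun s hs => ?_
  have hs' : 0 ≤ p - s := (sub_pos.2 hs.2).le
  push_cast [Complex.ofReal_cpow hs.1.le, Complex.ofReal_cpow hs']
  rfl

theorem integral_rpow_mul_sub_rpow_pos {p α β : ℝ} (hp : 0 < p) (hα : 0 < α) (hβ : 0 < β) :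
    0 < ∫ s in Set.Ioo 0 p, s ^ (α - 1) * (p - s) ^ (β - 1) := by
  rw [integral_rpow_mul_sub_rpow hp hα hβ]
  exact mul_pos (Real.rpow_pos_of_pos hp _) (rBeta_pos hα hβ)

theorem integrableOn_rpow_mul_sub_rpow {p α β : ℝ} (hp : 0 < p) (hα : 0 < α) (hβ : 0 < β) :
    IntegrableOn (fun s => s ^ (α - 1) * (p - s) ^ (β - 1)) (Set.Ioo 0 p) := by
  refine not_imp_comm.1 integral_undef ?_
  exact (integral_rpow_mul_sub_rpow_pos hp hα hβ).ne'

theorem hasSum_gbinom_natCast (N : ℕ) (w : ℝ) :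
    HasSum (fun l => gbinom N l * (-w) ^ l) ((1 - w) ^ N) := by
  have h : ∑ l ∈ Finset.range (N + 1), gbinom N l * (-w) ^ l = (1 - w) ^ N := by
    rw [sub_eq_neg_add, add_pow]
    refine Finset.sum_congr rfl fun l _ => ?_
    rw [gbinom_eq_choose, Ring.choose_natCast]
    ring
  rw [← h]
  refine hasSum_sum_of_ne_finset_zero fun l hl => ?_
  rw [gbinom_eq_choose, Ring.choose_natCast, Nat.choose_eq_zero_of_lt (by simpa using hl)]
  simp

theorem hasSum_gbinom_add_sub_one {a z : ℝ} (hz : 0 ≤ z) (hz' : z < 1) :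
    HasSum (fun n : ℕ => gbinom (a + n - 1) n * (-z) ^ n) (((1 + z) ^ a)⁻¹) := by
  have h := (Real.one_div_one_sub_rpow_hasFPowerSeriesOnBall_zero a).hasSum (y := -z)
    (by rw [← ENNReal.ofReal_one, Metric.eball_ofReal]; simpa [abs_of_nonneg hz] using hz')
  simpa [FormalMultilinearSeries.ofScalars, gbinom_eq_choose, List.prod_replicate] using h

theorem one_le_gbinom_add_sub_one {a : ℝ} (ha : 1 ≤ a) (n : ℕ) : 1 ≤ gbinom (a + n - 1) n := by
  rw [gbinom, one_le_div (by positivity), ← Nat.descFactorial_self,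
    Nat.descFactorial_eq_prod_range, Nat.cast_prod]
  refine Finset.prod_le_prod (fun i _ => by positivity) fun i hi => ?_
  rw [Nat.cast_sub (Finset.mem_range.1 hi).le]
  linarith

theorem lt_one_of_summable_gbinom {a z : ℝ} (ha : 1 ≤ a) (hz : 0 ≤ z)
    (h : Summable fun n : ℕ => gbinom (a + n - 1) n * z ^ n) : z < 1 := by
  have h' : Summable fun n : ℕ => z ^ n :=
    h.of_nonneg_of_le (fun n => by positivity)
      fun n => le_mul_of_one_le_left (by positivity) (one_le_gbinom_add_sub_one ha n)
  simpa [abs_of_nonneg hz] using summable_geometric_iff_norm_lt_one.1 h'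

theorem ae_summable_of_summable_integral_norm {α ι : Type*} [MeasurableSpace α] {μ : Measure α}
    [Countable ι] {F : ι → α → ℝ} (hF : ∀ i, Integrable (F i) μ)
    (hsum : Summable fun i => ∫ x, ‖F i x‖ ∂μ) : ∀ᵐ x ∂μ, Summable fun i => F i x := by
  have hne : ∫⁻ x, ∑' i, ‖F i x‖ₑ ∂μ ≠ ⊤ := by
    rw [lintegral_tsum fun i => (hF i).1.enorm]
    simp_rw [← ofReal_integral_norm_eq_lintegral_enorm (hF _)]
    exact hsum.tsum_ofReal_ne_top
  filter_upwards [ae_lt_top' (AEMeasurable.tsum fun i => (hF i).1.enorm) hne] with x hx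
  exact .of_nnnorm (ENNReal.tsum_coe_ne_top_iff_summable.1 hx.ne)

/-- Coefficient of `x ^ (a * (u + l + n) - 1)` in the expansion of `GBpdf a c d u v x`. -/
noncomputable def gbCoeff (a c d u v : ℝ) (l n : ℕ) : ℝ :=
  |a| / (d ^ (a * u) * rBeta u v) * ((-1) ^ (l + n) * (1 - c) ^ l * c ^ n / d ^ (a * ((l : ℝ) + n)))
    * gbinom (v - 1) l * gbinom (u + v + n - 1) n

theorem gbCoeff_mul_rpow {a c d u v x : ℝ} (hd : 0 < d) (hx : 0 < x) (l n : ℕ) :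
    gbCoeff a c d u v l n * x ^ (a * (u + l + n) - 1) =
      |a| * x ^ (a * u - 1) / (d ^ (a * u) * rBeta u v)
        * ((gbinom (v - 1) l * (-((1 - c) * (x / d) ^ a)) ^ l)
        * (gbinom (u + v + n - 1) n * (-(c * (x / d) ^ a)) ^ n)) := by
  have h₁ : x ^ (a * (u + l + n) - 1) = x ^ (a * u - 1) * (x ^ a) ^ l * (x ^ a) ^ n := by
    rw [← Real.rpow_mul_natCast hx.le, ← Real.rpow_mul_natCast hx.le, ← Real.rpow_add hx,
      ← Real.rpow_add hx]
    ring_nf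
  have h₂ : d ^ (a * ((l : ℝ) + n)) = (d ^ a) ^ l * (d ^ a) ^ n := by
    rw [← Real.rpow_mul_natCast hd.le, ← Real.rpow_mul_natCast hd.le, ← Real.rpow_add hd]
    ring_nf
  rw [gbCoeff, h₁, h₂, Real.div_rpow hx.le hd.le, neg_pow ((1 - c) * _), neg_pow (c * _),
    mul_pow, mul_pow, div_pow, div_pow]
  ring

theorem hasSum_gbCoeff_mul_rpow {a c d u v x : ℝ} {N : ℕ} (hd : 0 < d) (hx : 0 < x) (hc : 0 ≤ c)
    (hN : v - 1 = N) (hz : c * (x / d) ^ a < 1) :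
    HasSum (fun q : ℕ × ℕ => gbCoeff a c d u v q.1 q.2 * x ^ (a * (u + q.1 + q.2) - 1))
      (GBpdf a c d u v x) := by
  have h₁ := hasSum_gbinom_natCast N ((1 - c) * (x / d) ^ a)
  have h₂ := hasSum_gbinom_add_sub_one (a := u + v) (by positivity) hz
  have h := (h₁.mul h₂ (summable_mul_of_summable_norm h₁.summable.norm h₂.summable.norm)).mul_left
    (|a| * x ^ (a * u - 1) / (d ^ (a * u) * rBeta u v))
  simp_rw [gbCoeff_mul_rpow hd hx]
  convert! h using 1
  · simp_rw [hN]
  · rw [GBpdf, hN, Real.rpow_natCast]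
    ring

theorem mul_div_rpow_lt_one_of_summable {a c d u v x : ℝ} (ha : a ≠ 0) (hd : 0 < d)
    (hu : 0 < u) (hv : 0 < v) (huv : 1 ≤ u + v) (hx : 0 < x) (hc : 0 ≤ c)
    (h : Summable fun n : ℕ => gbCoeff a c d u v 0 n * x ^ (a * (u + (0 : ℕ) + n) - 1)) :
    c * (x / d) ^ a < 1 := by
  have hB := rBeta_pos hu hv
  have hK : |a| * x ^ (a * u - 1) / (d ^ (a * u) * rBeta u v) ≠ 0 := by positivity
  simp_rw [gbCoeff_mul_rpow hd hx] at h
  rw [summable_mul_left_iff hK] at h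
  refine lt_one_of_summable_gbinom huv (by positivity) (h.abs.congr fun n => ?_)
  have := one_le_gbinom_add_sub_one huv n
  have hz : 0 ≤ c * (x / d) ^ a := by positivity
  have h₀ : gbinom (v - 1) 0 = 1 := by simp [gbinom]
  rw [h₀, pow_zero, one_mul, one_mul, abs_mul, abs_pow, abs_neg, abs_of_nonneg hz,
    abs_of_pos (by linarith)]

theorem gbCoeff_ne_zero {a c d u v : ℝ} (ha : a ≠ 0) (hd : 0 < d) (hu : 0 < u) (hv : 0 < v) :
    gbCoeff a c d u v 0 0 ≠ 0 := by
  have hB := rBeta_pos hu hv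
  simp [gbCoeff, gbinom, ha, hB.ne', (Real.rpow_pos_of_pos hd _).ne']

theorem gbCoeff_mul_gbCoeff_mul_rBeta {a₁ c₁ d₁ u₁ v₁ a₂ c₂ d₂ u₂ v₂ p : ℝ} (hp : 0 < p)
    (l m n r : ℕ) :
    gbCoeff a₁ c₁ d₁ u₁ v₁ l n * gbCoeff a₂ c₂ d₂ u₂ v₂ m r
        * (p ^ (a₁ * (u₁ + l + n) + a₂ * (u₂ + m + r) - 1)
          * rBeta (a₁ * (u₁ + l + n)) (a₂ * (u₂ + m + r)))
      = (|a₁| * |a₂| / (d₁ ^ (a₁ * u₁) * d₂ ^ (a₂ * u₂) * rBeta u₁ v₁ * rBeta u₂ v₂))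
        * p ^ (a₁ * u₁ + a₂ * u₂ - 1)
        * gbTerm a₁ c₁ d₁ u₁ v₁ a₂ c₂ d₂ u₂ v₂ p (l, m, n, r) := by
  have h : p ^ (a₁ * (u₁ + l + n) + a₂ * (u₂ + m + r) - 1) = p ^ (a₁ * u₁ + a₂ * u₂ - 1)
      * p ^ (a₁ * ((l : ℝ) + n) + a₂ * ((m : ℝ) + r)) := by
    rw [← Real.rpow_add hp]
    ring_nf
  rw [h, gbCoeff, gbCoeff, gbTerm]
  ring

theorem Summable.left_of_mul_interleaved {f g : ℕ × ℕ → ℝ} (hg : g (0, 0) ≠ 0)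
    (h : Summable fun q : ℕ × ℕ × ℕ × ℕ => f (q.1, q.2.2.1) * g (q.2.1, q.2.2.2)) :
    Summable fun n => f (0, n) :=
  (summable_mul_right_iff hg).1 <|
    h.comp_injective (i := fun n : ℕ => (0, 0, n, 0)) fun i j h => by simpa using h

theorem Summable.right_of_mul_interleaved {f g : ℕ × ℕ → ℝ} (hf : f (0, 0) ≠ 0)
    (h : Summable fun q : ℕ × ℕ × ℕ × ℕ => f (q.1, q.2.2.1) * g (q.2.1, q.2.2.2)) :
    Summable fun r => g (0, r) :=
  (summable_mul_left_iff hf).1 <|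
    h.comp_injective (i := fun r : ℕ => (0, 0, 0, r)) fun i j h => by simpa using h

theorem HasSum.mul_interleaved {f g : ℕ × ℕ → ℝ} {x y : ℝ} (hf : HasSum f x) (hg : HasSum g y) :
    HasSum (fun q : ℕ × ℕ × ℕ × ℕ => f (q.1, q.2.2.1) * g (q.2.1, q.2.2.2)) (x * y) := by
  let e : (ℕ × ℕ) × (ℕ × ℕ) ≃ ℕ × ℕ × ℕ × ℕ :=
    ⟨fun q => (q.1.1, q.2.1, q.1.2, q.2.2), fun q => ((q.1, q.2.2.1), (q.2.1, q.2.2.2)),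
      fun _ => rfl, fun _ => rfl⟩
  exact e.hasSum_iff.1
    (hf.mul hg (summable_mul_of_summable_norm hf.summable.norm hg.summable.norm))

theorem exists_sub_one_eq_natCast {v : ℝ} (hv : 0 < v) (h : ∃ N : ℕ, v = N) :
    ∃ N : ℕ, v - 1 = N := by
  obtain ⟨M, rfl⟩ := h
  exact ⟨M - 1, by rw [Nat.cast_pred (by exact_mod_cast hv)]⟩

/-- Series representation of the marginal density of `P = S + B` when `S`, `B` are
independent with generalized beta densities, under absolute convergence of the series
and existence of the requisite integrals (the exponents `v₁`, `v₂` being nonnegative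
integers as needed for the binomial expansion). -/
theorem gb_convolution_marginal_series
    (a₁ c₁ d₁ u₁ v₁ a₂ c₂ d₂ u₂ v₂ p : ℝ)
    (ha₁ : 0 < a₁) (hd₁ : 0 < d₁) (hu₁ : 0 < u₁) (hv₁ : 0 < v₁)
    (ha₂ : 0 < a₂) (hd₂ : 0 < d₂) (hu₂ : 0 < u₂) (hv₂ : 0 < v₂)
    (hc₁ : 0 ≤ c₁) (hc₁' : c₁ ≤ 1) (hc₂ : 0 ≤ c₂) (hc₂' : c₂ ≤ 1)
    (hv₁nat : ∃ N : ℕ, v₁ = N) (hv₂nat : ∃ N : ℕ, v₂ = N)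
    (hp : 0 < p)
    (hsum : Summable (fun q : ℕ × ℕ × ℕ × ℕ =>
      |gbTerm a₁ c₁ d₁ u₁ v₁ a₂ c₂ d₂ u₂ v₂ p q|))
    (hint : IntegrableOn
      (fun s => GBpdf a₁ c₁ d₁ u₁ v₁ s * GBpdf a₂ c₂ d₂ u₂ v₂ (p - s)) (Set.Ioc 0 p)) :
    (∫ s in (0:ℝ)..p, GBpdf a₁ c₁ d₁ u₁ v₁ s * GBpdf a₂ c₂ d₂ u₂ v₂ (p - s))
      = (|a₁| * |a₂| / (d₁ ^ (a₁ * u₁) * d₂ ^ (a₂ * u₂) * rBeta u₁ v₁ * rBeta u₂ v₂))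
        * p ^ (a₁ * u₁ + a₂ * u₂ - 1)
        * ∑' q : ℕ × ℕ × ℕ × ℕ, gbTerm a₁ c₁ d₁ u₁ v₁ a₂ c₂ d₂ u₂ v₂ p q := by
  obtain ⟨N₁, hN₁⟩ := exists_sub_one_eq_natCast hv₁ hv₁nat
  obtain ⟨N₂, hN₂⟩ := exists_sub_one_eq_natCast hv₂ hv₂nat
  have h1v₁ : 1 ≤ v₁ := sub_nonneg.1 (hN₁ ▸ N₁.cast_nonneg)
  have h1v₂ : 1 ≤ v₂ := sub_nonneg.1 (hN₂ ▸ N₂.cast_nonneg)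
  let g₁ : ℝ → ℕ × ℕ → ℝ := fun s q =>
    gbCoeff a₁ c₁ d₁ u₁ v₁ q.1 q.2 * s ^ (a₁ * (u₁ + q.1 + q.2) - 1)
  let g₂ : ℝ → ℕ × ℕ → ℝ := fun s q =>
    gbCoeff a₂ c₂ d₂ u₂ v₂ q.1 q.2 * s ^ (a₂ * (u₂ + q.1 + q.2) - 1)
  let F : ℕ × ℕ × ℕ × ℕ → ℝ → ℝ := fun q s =>
    g₁ s (q.1, q.2.2.1) * g₂ (p - s) (q.2.1, q.2.2.2)
  set K := (|a₁| * |a₂| / (d₁ ^ (a₁ * u₁) * d₂ ^ (a₂ * u₂) * rBeta u₁ v₁ * rBeta u₂ v₂))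
        * p ^ (a₁ * u₁ + a₂ * u₂ - 1)
  have hα (l n : ℕ) : 0 < a₁ * (u₁ + l + n) := by positivity
  have hβ (m r : ℕ) : 0 < a₂ * (u₂ + m + r) := by positivity
  have hF (q : ℕ × ℕ × ℕ × ℕ) : F q = fun s =>
      gbCoeff a₁ c₁ d₁ u₁ v₁ q.1 q.2.2.1 * gbCoeff a₂ c₂ d₂ u₂ v₂ q.2.1 q.2.2.2
        * (s ^ (a₁ * (u₁ + q.1 + q.2.2.1) - 1) * (p - s) ^ (a₂ * (u₂ + q.2.1 + q.2.2.2) - 1)) :=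
    funext fun s => mul_mul_mul_comm _ _ _ _
  have hFint (q) : IntegrableOn (F q) (Set.Ioo 0 p) := by
    rw [hF]
    exact (integrableOn_rpow_mul_sub_rpow hp (hα _ _) (hβ _ _)).const_mul _
  have hFval (q) : ∫ s in Set.Ioo 0 p, F q s = K * gbTerm a₁ c₁ d₁ u₁ v₁ a₂ c₂ d₂ u₂ v₂ p q := by
    rw [hF, integral_const_mul, integral_rpow_mul_sub_rpow hp (hα _ _) (hβ _ _),
      gbCoeff_mul_gbCoeff_mul_rBeta hp]
  have hFnorm (q) : ∫ s in Set.Ioo 0 p, ‖F q s‖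
      = |K * gbTerm a₁ c₁ d₁ u₁ v₁ a₂ c₂ d₂ u₂ v₂ p q| := by
    rw [← hFval, hF, integral_const_mul, abs_mul,
      abs_of_pos (integral_rpow_mul_sub_rpow_pos hp (hα _ _) (hβ _ _)), ← integral_const_mul]
    refine setIntegral_congr_fun measurableSet_Ioo fun s hs => ?_
    have hs' : 0 ≤ p - s := (sub_pos.2 hs.2).le
    have hs₀ : 0 ≤ s := hs.1.le
    simp only [Real.norm_eq_abs]
    rw [abs_mul, abs_of_nonneg (a := _ ^ _ * _ ^ _) (by positivity)]
  have hFsum : Summable fun q => ∫ s in Set.Ioo 0 p, ‖F q s‖ := by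
    simp_rw [hFnorm, abs_mul]
    exact hsum.mul_left _
  have hpt : ∀ᵐ s ∂volume.restrict (Set.Ioo 0 p),
      GBpdf a₁ c₁ d₁ u₁ v₁ s * GBpdf a₂ c₂ d₂ u₂ v₂ (p - s) = ∑' q, F q s := by
    filter_upwards [ae_summable_of_summable_integral_norm hFint hFsum,
      ae_restrict_mem measurableSet_Ioo] with s hs hmem
    have hs₁ : 0 < s := hmem.1
    have hs₂ : 0 < p - s := sub_pos.2 hmem.2
    have hz₁ : c₁ * (s / d₁) ^ a₁ < 1 :=
      mul_div_rpow_lt_one_of_summable ha₁.ne' hd₁ hu₁ hv₁ (by linarith) hs₁ hc₁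
        (Summable.left_of_mul_interleaved (f := g₁ s) (g := g₂ (p - s))
          (mul_ne_zero (gbCoeff_ne_zero ha₂.ne' hd₂ hu₂ hv₂) (Real.rpow_pos_of_pos hs₂ _).ne') hs)
    have hz₂ : c₂ * ((p - s) / d₂) ^ a₂ < 1 :=
      mul_div_rpow_lt_one_of_summable ha₂.ne' hd₂ hu₂ hv₂ (by linarith) hs₂ hc₂
        (Summable.right_of_mul_interleaved (f := g₁ s) (g := g₂ (p - s))
          (mul_ne_zero (gbCoeff_ne_zero ha₁.ne' hd₁ hu₁ hv₁) (Real.rpow_pos_of_pos hs₁ _).ne') hs)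
    have h₁ : HasSum (g₁ s) _ := hasSum_gbCoeff_mul_rpow hd₁ hs₁ hc₁ hN₁ hz₁
    have h₂ : HasSum (g₂ (p - s)) _ := hasSum_gbCoeff_mul_rpow hd₂ hs₂ hc₂ hN₂ hz₂
    exact (h₁.mul_interleaved h₂).tsum_eq.symm
  rw [intervalIntegral.integral_of_le hp.le, integral_Ioc_eq_integral_Ioo, integral_congr_ae hpt,
    ← integral_tsum_of_summable_integral_norm hFint hFsum, ← tsum_mul_left]
  exact tsum_congr hFval
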